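/- Let r = 2ℓ + 1 be an odd integer with ℓ ≥ 2, and let G be a graph with maximum degree Δ ≥ 3. Then the r-acyclic choice number of G satisfies A_r^l(G) ≤ ⌈ Δ^ℓ + (2 + ℓ + (1/2)·(r+2)^6)·Δ^((r+1)/3) ⌉. -/

import Mathlib

/-- An `r`-acyclic coloring is a proper vertex coloring such that every cycle `C`
receives at least `min |C| r` distinct colors. -/
def IsRAcyclicColoring {V : Type} (G : SimpleGraph V) (r : ℕ) (c : V → ℕ) : Prop :=
  (∀ u v, G.Adj u v → c u ≠ c v) ∧
  ∀ (v : V) (w : G.Walk v v), w.IsCycle → min w.length r ≤ (w.support.map c).toFinset.card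

/-- The `r`-acyclic choice number: the least `k` such that for every assignment of
lists of size `k` to the vertices there is an `r`-acyclic coloring from the lists. -/
noncomputable def rAcyclicChoiceNumber {V : Type} (G : SimpleGraph V) (r : ℕ) : ℕ :=
  sInf {k | ∀ L : V → Finset ℕ, (∀ v, (L v).card = k) →
    ∃ c : V → ℕ, (∀ v, c v ∈ L v) ∧ IsRAcyclicColoring G r c}

open Finset in
/-- Rosenfeld's counting argument. If every conflict created by coloring `v` is witnessed by one of
the certificates in `ι v`, each of which expresses the colors on a set `D` of size `w + 1` containing
`v` in terms of the colors outside `D`, and `β + ∑ β⁻¹ ^ w ≤ N`, then each newly colored vertex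
multiplies the number of valid colorings from lists of size `N` by at least `β`. -/
theorem exists_valid_coloring_of_certificates {V : Type*} [Fintype V] [DecidableEq V]
    (L : V → Finset ℕ) (N : ℕ) (hL : ∀ v, (L v).card = N)
    (Valid : Finset V → (V → ℕ) → Prop)
    (hmono : ∀ S S' c, S ⊆ S' → Valid S' c → Valid S c)
    (hlocal : ∀ S c c', (∀ v ∈ S, c v = c' v) → Valid S c → Valid S c')
    (hempty : ∀ c, Valid ∅ c)
    (β : ℝ) (hβ : 0 < β) (ι : V → Type*) [∀ v, Fintype (ι v)]
    (D : ∀ v, ι v → Finset V) (m : ∀ v, ι v → V → V) (w : ∀ v, ι v → ℕ)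
    (hcover : ∀ S v c, v ∉ S → Valid S c → ¬ Valid (insert v S) c →
      ∃ i : ι v, v ∈ D v i ∧ D v i ⊆ insert v S ∧ (D v i).card = w v i + 1 ∧
        ∀ d ∈ D v i, m v i d ∈ S \ D v i ∧ c d = c (m v i d))
    (hsum : ∀ v, β + ∑ i, β⁻¹ ^ w v i ≤ N) :
    ∃ c : V → ℕ, (∀ v, c v ∈ L v) ∧ Valid univ c := by
  classical
  set Q : Finset V → Finset (V → ℕ) := fun S =>
    Fintype.piFinset fun v => if v ∈ S then L v else {0} with hQ
  set K : Finset V → Finset (V → ℕ) := fun S => (Q S).filter (Valid S) with hK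
  have memQ : ∀ S c, c ∈ Q S ↔ ∀ v, (v ∈ S → c v ∈ L v) ∧ (v ∉ S → c v = 0) := by
    intro S c
    simp only [hQ, Fintype.mem_piFinset]
    refine forall_congr' fun v => ?_
    by_cases hv : v ∈ S <;> simp [hv]
  have memK : ∀ S c, c ∈ K S ↔ c ∈ Q S ∧ Valid S c := by
    intro S c; simp [hK]
  have step : ∀ n, ∀ S : Finset V, S.card = n → ∀ v ∉ S,
      β * (K S).card ≤ ((K (insert v S)).card : ℝ) := by
    intro n
    induction n using Nat.strong_induction_on with
    | _ n ih =>
    intro S hS v hv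
    have chain : ∀ A : Finset V, A ⊆ S → β ^ A.card * (K (S \ A)).card ≤ ((K S).card : ℝ) := by
      intro A
      induction A using Finset.induction_on with
      | empty => intro _; simp
      | insert a A ha ihA =>
        intro hA
        have haS : a ∈ S := hA (mem_insert_self _ _)
        have hAS : A ⊆ S := fun x hx => hA (mem_insert_of_mem hx)
        have h1 : insert a (S \ insert a A) = S \ A := by
          ext x
          simp only [mem_insert, mem_sdiff, not_or]
          constructor
          · rintro (rfl | h)
            · exact ⟨haS, ha⟩
            · exact ⟨h.1, h.2.2⟩
          · rintro ⟨h, h'⟩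
            by_cases hx : x = a
            · exact Or.inl hx
            · exact Or.inr ⟨h, hx, h'⟩
        have hlt : (S \ insert a A).card < n := by
          rw [← hS]
          exact card_lt_card (sdiff_ssubset hA (insert_nonempty _ _))
        have h2 := ih _ hlt (S \ insert a A) rfl a (by simp)
        rw [h1] at h2
        rw [card_insert_of_notMem ha, pow_succ, mul_assoc]
        exact (mul_le_mul_of_nonneg_left h2 (by positivity)).trans (ihA hAS)
    set E := (Q (insert v S)).filter (Valid S) with hE
    have hEcard : (K S).card * N ≤ E.card := by
      rw [← hL v, ← card_product]
      refine card_le_card_of_injOn (fun x => Function.update x.1 v x.2) ?_ ?_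
      · rintro ⟨c, x⟩ hx
        simp only [coe_product, Set.mem_prod, mem_coe, memK, memQ] at hx
        simp only [hE, coe_filter, Set.mem_ofPred_eq, memQ]
        refine ⟨fun u => ?_, hlocal S c _ ?_ hx.1.2⟩
        · by_cases huv : u = v
          · subst huv; simp [hx.2]
          · simpa [huv] using hx.1.1 u
        · intro u hu
          rw [Function.update_of_ne]
          rintro rfl; exact hv hu
      · rintro ⟨c, x⟩ hx ⟨c', x'⟩ hx' heq
        simp only [coe_product, Set.mem_prod, mem_coe, memK, memQ] at hx hx'
        have h1 : x = x' := by simpa using congrFun heq v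
        refine Prod.ext (funext fun u => ?_) h1
        by_cases huv : u = v
        · subst huv
          simp [(hx.1.1 u).2 hv, (hx'.1.1 u).2 hv]
        · simpa [huv] using congrFun heq u
    set B : ι v → Finset (V → ℕ) := fun i => E.filter fun c =>
      v ∈ D v i ∧ D v i ⊆ insert v S ∧ (D v i).card = w v i + 1 ∧
        ∀ d ∈ D v i, m v i d ∈ S \ D v i ∧ c d = c (m v i d) with hB
    have hEsub : E ⊆ K (insert v S) ∪ univ.biUnion B := by
      intro c hc
      have hc' := hc
      rw [hE, mem_filter] at hc'
      by_cases hval : Valid (insert v S) c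
      · exact mem_union_left _ ((memK _ _).2 ⟨hc'.1, hval⟩)
      · obtain ⟨i, hi⟩ := hcover S v c hv hc'.2 hval
        exact mem_union_right _ (mem_biUnion.2 ⟨i, mem_univ _, mem_filter.2 ⟨hc, hi⟩⟩)
    have hBcard : ∀ i, ((B i).card : ℝ) ≤ β⁻¹ ^ w v i * (K S).card := by
      intro i
      by_cases hi : v ∈ D v i ∧ D v i ⊆ insert v S ∧ (D v i).card = w v i + 1
      · have h1 : (B i).card ≤ (K (S \ D v i)).card := by
          refine card_le_card_of_injOn (fun c u => if u ∈ S \ D v i then c u else 0) ?_ ?_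
          · intro c hc
            simp only [hB, hE, coe_filter, mem_filter, Set.mem_ofPred_eq, memQ] at hc
            rw [mem_coe, memK, memQ]
            refine ⟨fun u => ⟨fun hu => ?_, fun hu => by simp only [if_neg hu]⟩, ?_⟩
            · simp only [if_pos hu]
              exact (hc.1.1 u).1 (mem_insert_of_mem (mem_sdiff.1 hu).1)
            · refine hlocal _ c _ (fun u hu => by simp only [if_pos hu]) ?_
              exact hmono _ _ _ sdiff_subset hc.1.2
          · intro c hc c' hc' heq
            simp only [hB, hE, coe_filter, mem_filter, Set.mem_ofPred_eq, memQ] at hc hc'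
            have hagree : ∀ u ∈ S \ D v i, c u = c' u := by
              intro u hu
              simpa only [if_pos hu] using congrFun heq u
            funext u
            by_cases huD : u ∈ D v i
            · rw [(hc.2.2.2.2 u huD).2, (hc'.2.2.2.2 u huD).2]
              exact hagree _ (hc.2.2.2.2 u huD).1
            · by_cases huS : u ∈ S
              · exact hagree u (mem_sdiff.2 ⟨huS, huD⟩)
              · have hu : u ∉ insert v S := by
                  rw [mem_insert]; rintro (rfl | h)
                  · exact huD hi.1
                  · exact huS h
                rw [(hc.1.1 u).2 hu, (hc'.1.1 u).2 hu]
        have h2 : S \ D v i = S \ (D v i).erase v := by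
          ext x
          simp only [mem_sdiff, mem_erase, not_and]
          constructor
          · rintro ⟨h, h'⟩; exact ⟨h, fun _ => h'⟩
          · rintro ⟨h, h'⟩; exact ⟨h, h' (by rintro rfl; exact hv h)⟩
        have h3 := chain ((D v i).erase v) (by
          intro x hx
          rw [mem_erase] at hx
          exact (mem_insert.1 (hi.2.1 hx.2)).resolve_left hx.1)
        rw [← h2, card_erase_of_mem hi.1, hi.2.2, Nat.add_sub_cancel] at h3
        rw [inv_pow, inv_mul_eq_div, le_div_iff₀ (by positivity), mul_comm]
        refine le_trans ?_ h3
        gcongr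
      · have : B i = ∅ := by
          refine filter_eq_empty_iff.2 fun c _ hc => hi ⟨hc.1, hc.2.1, hc.2.2.1⟩
        rw [this]; simp; positivity
    have htot : ((K S).card : ℝ) * N ≤
        (K (insert v S)).card + ∑ i, β⁻¹ ^ w v i * (K S).card := by
      calc ((K S).card : ℝ) * N ≤ E.card := by exact_mod_cast hEcard
        _ ≤ ((K (insert v S)).card + ∑ i, (B i).card : ℕ) := by
            exact_mod_cast (card_le_card hEsub).trans
              ((card_union_le _ _).trans (Nat.add_le_add_left card_biUnion_le _))
        _ ≤ _ := by push_cast; gcongr with i; exact hBcard i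
    rw [← sum_mul] at htot
    have := mul_le_mul_of_nonneg_left (hsum v) (Nat.cast_nonneg (α := ℝ) (K S).card)
    nlinarith
  have pos : ∀ S : Finset V, 0 < (K S).card := by
    intro S
    induction S using Finset.induction_on with
    | empty =>
      refine card_pos.2 ⟨fun _ => 0, (memK _ _).2 ⟨(memQ _ _).2 fun v => by simp, hempty _⟩⟩
    | insert a S ha ihS =>
      have h := step _ S rfl a ha
      have : (0 : ℝ) < (K (insert a S)).card :=
        lt_of_lt_of_le (mul_pos hβ (by exact_mod_cast ihS)) h
      exact_mod_cast this
  obtain ⟨c, hc⟩ := card_pos.1 (pos univ)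
  rw [memK, memQ] at hc
  exact ⟨c, fun v => (hc.1 v).1 (mem_univ v), hc.2⟩

namespace SimpleGraph

variable {V : Type*} [Fintype V] [DecidableEq V] (G : SimpleGraph V) [DecidableRel G.Adj]

theorem sum_adjMatrix_pow_le (n : ℕ) (v : V) :
    ∑ u, (G.adjMatrix ℕ ^ n) v u ≤ G.maxDegree ^ n := by
  induction n generalizing v with
  | zero => simp [Matrix.one_apply]
  | succ n ih =>
    simp only [pow_succ' (G.adjMatrix ℕ), adjMatrix_mul_apply]
    rw [Finset.sum_comm]
    calc ∑ x ∈ G.neighborFinset v, ∑ u, (G.adjMatrix ℕ ^ n) x u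
        ≤ ∑ x ∈ G.neighborFinset v, G.maxDegree ^ n := Finset.sum_le_sum fun x _ => ih x
      _ = G.degree v * G.maxDegree ^ n := by simp
      _ ≤ G.maxDegree ^ (n + 1) := by
        rw [pow_succ']
        exact Nat.mul_le_mul_right _ (G.degree_le_maxDegree v)

theorem adjMatrix_pow_apply_comm (n : ℕ) (u v : V) :
    (G.adjMatrix ℕ ^ n) u v = (G.adjMatrix ℕ ^ n) v u := by
  have h := congrFun (congrFun (Matrix.transpose_pow (G.adjMatrix ℕ) n) v) u
  rwa [transpose_adjMatrix, Matrix.transpose_apply] at h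

/-- The walks of length `n` starting at `v`. -/
abbrev WalksFrom (v : V) (n : ℕ) : Type _ := Σ u, {p : G.Walk v u | p.length = n}

theorem card_walksFrom_le (v : V) (n : ℕ) :
    Fintype.card (G.WalksFrom v n) ≤ G.maxDegree ^ n := by
  rw [Fintype.card_sigma]
  refine le_trans (le_of_eq (Finset.sum_congr rfl fun u _ => ?_)) (G.sum_adjMatrix_pow_le n v)
  rw [adjMatrix_pow_apply_eq_card_walk]
  simp

open Finset in
open scoped Classical in
theorem card_filter_walk_length_le (k : ℕ) (hk : 1 ≤ k) (v : V) :
    #{w | v ≠ w ∧ ∃ p : G.Walk v w, p.length ≤ k} ≤ G.maxDegree ^ k := by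
  induction k, hk using Nat.le_induction with
  | base =>
    rw [pow_one]
    refine le_trans (card_le_card fun w hw => ?_) (G.degree_le_maxDegree v)
    obtain ⟨hne, p, hp⟩ := (mem_filter.1 hw).2
    rw [mem_neighborFinset]
    refine Walk.adj_of_length_eq_one (p := p) ?_
    have : p.length ≠ 0 := fun h => hne (Walk.eq_of_length_eq_zero h)
    omega
  | succ k hk ih =>
    set A : Finset V := {w | v ≠ w ∧ ∃ p : G.Walk v w, p.length ≤ k} with hA
    let F : V → Finset V := fun y =>
      if G.Adj v y then insert y ((G.neighborFinset y).erase v) else G.neighborFinset y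
    have hF : ∀ y, #(F y) ≤ G.maxDegree := by
      intro y
      simp only [F]
      split_ifs with h
      · refine le_trans (card_insert_le _ _) ?_
        rw [card_erase_of_mem (by simpa using h.symm), card_neighborFinset_eq_degree]
        have h1 : 0 < G.degree y := (G.degree_pos_iff_exists_adj y).2 ⟨v, h.symm⟩
        have h2 := G.degree_le_maxDegree y
        omega
      · rw [card_neighborFinset_eq_degree]; exact G.degree_le_maxDegree y
    have hsub : ({w | v ≠ w ∧ ∃ p : G.Walk v w, p.length ≤ k + 1} : Finset V) ⊆ A.biUnion F := by
      intro w hw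
      obtain ⟨hne, p, hp⟩ := (mem_filter.1 hw).2
      rw [mem_biUnion]
      by_cases hvw : G.Adj v w
      · refine ⟨w, mem_filter.2 ⟨mem_univ _, hne, hvw.toWalk, by simpa using hk⟩, ?_⟩
        simp [F, hvw]
      · have hnil : ¬ p.Nil := fun h => hne h.eq
        have hadj : G.Adj p.penultimate w := p.adj_penultimate hnil
        have hpv : v ≠ p.penultimate := by
          intro h; rw [← h] at hadj; exact hvw hadj
        refine ⟨p.penultimate, mem_filter.2 ⟨mem_univ _, hpv, p.dropLast, ?_⟩, ?_⟩
        · have := p.length_dropLast_add_one hnil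
          omega
        · simp only [F]
          split_ifs
          · exact mem_insert_of_mem (mem_erase.2 ⟨hne.symm, by simpa using hadj⟩)
          · simpa using hadj
    calc _ ≤ #(A.biUnion F) := card_le_card hsub
      _ ≤ ∑ y ∈ A, #(F y) := card_biUnion_le
      _ ≤ ∑ y ∈ A, G.maxDegree := sum_le_sum fun y _ => hF y
      _ = #A * G.maxDegree := by simp
      _ ≤ _ := by rw [pow_succ]; exact Nat.mul_le_mul_right _ ih

end SimpleGraph

open Finset in
theorem exists_dependent_triple {V : Type*} [DecidableEq V] {X : Finset V} {c : V → ℕ} {v : V}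
    (hX : #(X.image c) + 3 ≤ #X) (hv : v ∈ X)
    (herase : #(X.erase v) ≤ #((X.erase v).image c) + 2) :
    ∃ x y, ∃ f : V → V, #{v, x, y} = 3 ∧ x ∈ X ∧ y ∈ X ∧
      ∀ d ∈ ({v, x, y} : Finset V), f d ∈ X \ {v, x, y} ∧ c d = c (f d) := by
  classical
  have hcard := card_erase_add_one hv
  have himg : (X.erase v).image c = X.image c := by
    refine eq_of_subset_of_card_le (image_subset_image (erase_subset _ _)) ?_
    omega
  have hrep : ∀ k, ∃ b, k ∈ X.image c → b ∈ X.erase v ∧ c b = k := by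
    intro k
    by_cases hk : k ∈ X.image c
    · obtain ⟨b, hb, h⟩ := mem_image.1 (himg ▸ hk)
      exact ⟨b, fun _ => ⟨hb, h⟩⟩
    · exact ⟨v, fun h => absurd h hk⟩
  choose g hg using hrep
  set R := (X.image c).image g with hR
  have hRcard : #R ≤ #(X.image c) := card_image_le
  have hRsub : ∀ b ∈ R, b ∈ X.erase v := by
    intro b hb
    obtain ⟨k, hk, rfl⟩ := mem_image.1 hb
    exact (hg k hk).1
  have hvR : v ∈ X \ R := mem_sdiff.2 ⟨hv, fun h => by simpa using hRsub v h⟩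
  have htwo : 1 < #((X \ R).erase v) := by
    have h1 := card_erase_add_one hvR
    have h2 := le_card_sdiff R X
    omega
  obtain ⟨x, hx, y, hy, hxy⟩ := one_lt_card.1 htwo
  rw [mem_erase] at hx hy
  have hsub : ({v, x, y} : Finset V) ⊆ X \ R := by
    intro d hd
    simp only [mem_insert, mem_singleton] at hd
    rcases hd with rfl | rfl | rfl
    exacts [hvR, hx.2, hy.2]
  refine ⟨x, y, fun d => g (c d), card_eq_three.2 ⟨v, x, y, hx.1.symm, hy.1.symm, hxy, rfl⟩,
    (mem_sdiff.1 hx.2).1, (mem_sdiff.1 hy.2).1, fun d hd => ?_⟩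
  have hdX := mem_image_of_mem c (mem_sdiff.1 (hsub hd)).1
  have hgR : g (c d) ∈ R := mem_image_of_mem g hdX
  exact ⟨mem_sdiff.2 ⟨mem_of_mem_erase (hg _ hdX).1, fun h => (mem_sdiff.1 (hsub h)).2 hgR⟩,
    (hg _ hdX).2.symm⟩

namespace SimpleGraph

variable {V : Type*} (G : SimpleGraph V)

/-- `a, b, a', b'` are distinct and are met in this order along a closed walk of length `2 * k`
in which `a, a'` and `b, b'` are antipodal. -/
def AntipodalPairs (k : ℕ) (a b a' b' : V) : Prop :=
  (a ≠ b ∧ a ≠ a' ∧ a ≠ b' ∧ b ≠ a' ∧ b ≠ b' ∧ a' ≠ b') ∧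
  ∃ i j, i + j = k ∧ (∃ p : G.Walk a b, p.length = i) ∧ (∃ p : G.Walk b a', p.length = j) ∧
    (∃ p : G.Walk a' b', p.length = i) ∧ ∃ p : G.Walk b' a, p.length = j

variable {G} in
theorem AntipodalPairs.rotate {k : ℕ} {a b a' b' : V} (h : G.AntipodalPairs k a b a' b') :
    G.AntipodalPairs k b a' b' a := by
  obtain ⟨⟨h1, h2, h3, h4, h5, h6⟩, i, j, hij, p1, p2, p3, p4⟩ := h
  exact ⟨⟨h4, h5, h1.symm, h6, h2.symm, h3.symm⟩, j, i, by omega, p2, p3, p4, p1⟩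

variable {G} in
theorem AntipodalPairs.exists_walks {k : ℕ} {a b a' b' : V} (h : G.AntipodalPairs k a b a' b') :
    ∃ j ≤ k, ∃ p q : G.Walk a a', p.length = k ∧ q.length = k ∧
      p.getVert j = b ∧ q.getVert (k - j) = b' := by
  obtain ⟨-, i, j, hij, ⟨p1, h1⟩, ⟨p2, h2⟩, ⟨p3, h3⟩, ⟨p4, h4⟩⟩ := h
  refine ⟨i, by omega, p1.append p2, p4.reverse.append p3.reverse, by simp; omega,
    by simp; omega, ?_, ?_⟩
  · rw [Walk.getVert_append, h1]; simp
  · rw [Walk.getVert_append]; simp [h4, ← hij]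

/-- Two distinct vertices which are joined by a walk of length at most `ℓ`, or by more than `T`
walks of length `ℓ + 1`. -/
def Conflict [Fintype V] [DecidableEq V] [DecidableRel G.Adj] (ℓ : ℕ) (T : ℝ) (u v : V) : Prop :=
  u ≠ v ∧ ((∃ p : G.Walk u v, p.length ≤ ℓ) ∨ T < ((G.adjMatrix ℕ ^ (ℓ + 1)) u v : ℝ))

section

variable [Fintype V] [DecidableEq V] [DecidableRel G.Adj]

variable {G} in
theorem Conflict.symm {ℓ : ℕ} {T : ℝ} {u v : V} (h : G.Conflict ℓ T u v) : G.Conflict ℓ T v u := by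
  refine ⟨h.1.symm, h.2.imp (fun ⟨p, hp⟩ => ⟨p.reverse, by simpa using hp⟩) fun h => ?_⟩
  rwa [adjMatrix_pow_apply_comm]

open Finset in
open scoped Classical in
theorem card_filter_conflict_le (ℓ : ℕ) (hℓ : 1 ≤ ℓ) (T : ℝ) (hT : 0 < T) (v : V)
    (hT3 : (G.maxDegree : ℝ) ^ (ℓ + 1) ≤ T ^ 3) :
    (#{u | G.Conflict ℓ T v u} : ℝ) ≤ (G.maxDegree : ℝ) ^ ℓ + T ^ 2 := by
  have hsub : ({u | G.Conflict ℓ T v u} : Finset V) ⊆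
      ({w | v ≠ w ∧ ∃ p : G.Walk v w, p.length ≤ ℓ} : Finset V) ∪
      ({u | T < ((G.adjMatrix ℕ ^ (ℓ + 1)) v u : ℝ)} : Finset V) := by
    intro u hu
    obtain ⟨hne, h⟩ := (mem_filter.1 hu).2
    rw [mem_union, mem_filter, mem_filter]
    exact h.imp (fun h => ⟨mem_univ _, hne, h⟩) fun h => ⟨mem_univ _, h⟩
  have hspecial : (#{u | T < ((G.adjMatrix ℕ ^ (ℓ + 1)) v u : ℝ)} : ℝ) ≤ T ^ 2 := by
    have h1 : (#{u | T < ((G.adjMatrix ℕ ^ (ℓ + 1)) v u : ℝ)} : ℝ) * T ≤ T ^ 3 := by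
      calc (#{u | T < ((G.adjMatrix ℕ ^ (ℓ + 1)) v u : ℝ)} : ℝ) * T
          = ∑ u with T < ((G.adjMatrix ℕ ^ (ℓ + 1)) v u : ℝ), T := by simp
        _ ≤ ∑ u with T < ((G.adjMatrix ℕ ^ (ℓ + 1)) v u : ℝ),
              ((G.adjMatrix ℕ ^ (ℓ + 1)) v u : ℝ) :=
            sum_le_sum fun u hu => (mem_filter.1 hu).2.le
        _ ≤ ∑ u, ((G.adjMatrix ℕ ^ (ℓ + 1)) v u : ℝ) :=
            sum_le_sum_of_subset_of_nonneg (filter_subset _ _) fun _ _ _ => by positivity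
        _ ≤ (G.maxDegree : ℝ) ^ (ℓ + 1) := by exact_mod_cast G.sum_adjMatrix_pow_le (ℓ + 1) v
        _ ≤ T ^ 3 := hT3
    nlinarith
  calc (#{u | G.Conflict ℓ T v u} : ℝ)
      ≤ #({w | v ≠ w ∧ ∃ p : G.Walk v w, p.length ≤ ℓ} : Finset V) +
        #({u | T < ((G.adjMatrix ℕ ^ (ℓ + 1)) v u : ℝ)} : Finset V) := by
        exact_mod_cast (card_le_card hsub).trans (card_union_le _ _)
    _ ≤ _ := by
      gcongr
      exact_mod_cast G.card_filter_walk_length_le ℓ hℓ v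

/-- A certificate for a monochromatic conflicting pair, two monochromatic antipodal pairs, or three
repetitions along a walk of length `n`, created by coloring the vertex `v`. -/
abbrev Certificate (ℓ n : ℕ) (T : ℝ) (v : V) : Type _ :=
  {u // G.Conflict ℓ T v u} ⊕
  ((Σ u : {u // ¬ T < ((G.adjMatrix ℕ ^ (ℓ + 1)) v u : ℝ)},
    {p : G.Walk v u | p.length = ℓ + 1} × {p : G.Walk v u | p.length = ℓ + 1}) × Fin (ℓ + 2)) ⊕
  (Σ i : Fin (n + 1), G.WalksFrom v i × G.WalksFrom v (n - i) × (Fin 5 → Fin (n + 1)))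

theorem card_walk_pairs_le (ℓ : ℕ) (T : ℝ) (hT : 0 < T) (v : V) :
    (Fintype.card (Σ u : {u // ¬ T < ((G.adjMatrix ℕ ^ (ℓ + 1)) v u : ℝ)},
      {p : G.Walk v u | p.length = ℓ + 1} × {p : G.Walk v u | p.length = ℓ + 1}) : ℝ) ≤
      T * (G.maxDegree : ℝ) ^ (ℓ + 1) := by
  have hcard : ∀ u, (Fintype.card {p : G.Walk v u | p.length = ℓ + 1} : ℝ) =
      ((G.adjMatrix ℕ ^ (ℓ + 1)) v u : ℝ) := by
    intro u
    rw [adjMatrix_pow_apply_eq_card_walk]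
    simp
  rw [Fintype.card_sigma]
  push_cast [Fintype.card_prod, hcard]
  calc _ ≤ ∑ u : {u // ¬ T < ((G.adjMatrix ℕ ^ (ℓ + 1)) v u : ℝ)},
        T * ((G.adjMatrix ℕ ^ (ℓ + 1)) v u : ℝ) :=
        Finset.sum_le_sum fun u _ => mul_le_mul_of_nonneg_right (not_lt.1 u.2) (by positivity)
    _ ≤ ∑ u, T * ((G.adjMatrix ℕ ^ (ℓ + 1)) v u : ℝ) := by
        rw [← Fintype.sum_subtype_add_sum_subtype
          (fun u => T < ((G.adjMatrix ℕ ^ (ℓ + 1)) v u : ℝ))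
          fun u => T * ((G.adjMatrix ℕ ^ (ℓ + 1)) v u : ℝ)]
        exact le_add_of_nonneg_left (Finset.sum_nonneg fun _ _ => by positivity)
    _ ≤ _ := by
        rw [← Finset.mul_sum]
        gcongr
        exact_mod_cast G.sum_adjMatrix_pow_le (ℓ + 1) v

theorem card_split_walks_le (n : ℕ) (v : V) :
    Fintype.card (Σ i : Fin (n + 1), G.WalksFrom v i × G.WalksFrom v (n - i) ×
      (Fin 5 → Fin (n + 1))) ≤ (n + 1) ^ 6 * G.maxDegree ^ n := by
  rw [Fintype.card_sigma]
  calc _ ≤ ∑ i : Fin (n + 1), G.maxDegree ^ n * (n + 1) ^ 5 := by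
        refine Finset.sum_le_sum fun i _ => ?_
        rw [Fintype.card_prod, Fintype.card_prod, ← mul_assoc]
        refine Nat.mul_le_mul ?_ (by simp)
        refine (Nat.mul_le_mul (G.card_walksFrom_le v i) (G.card_walksFrom_le v (n - i))).trans ?_
        rw [← pow_add, Nat.add_sub_cancel' (by omega)]
    _ = _ := by
        simp
        ring

end

end SimpleGraph

open SimpleGraph

/-- The properties of a coloring of `S` which are maintained while coloring vertex by vertex. -/
def IsGoodOn {V : Type*} [Fintype V] [DecidableEq V] (G : SimpleGraph V) [DecidableRel G.Adj]
    (ℓ n : ℕ) (T : ℝ) (S : Finset V) (c : V → ℕ) : Prop :=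
  (∀ u ∈ S, ∀ v ∈ S, G.Conflict ℓ T u v → c u ≠ c v) ∧
  (∀ a ∈ S, ∀ b ∈ S, ∀ a' ∈ S, ∀ b' ∈ S, G.AntipodalPairs (ℓ + 1) a b a' b' →
    ¬ (c a = c a' ∧ c b = c b')) ∧
  ∀ (x y : V) (p : G.Walk x y), p.length = n → ∀ X ⊆ S, X ⊆ p.support.toFinset →
    X.card ≤ (X.image c).card + 2

section

variable {V : Type*} [Fintype V] [DecidableEq V] (G : SimpleGraph V) [DecidableRel G.Adj]

open Finset in
open scoped Classical in
theorem exists_isGoodOn_univ (ℓ n N : ℕ) (hℓ : 1 ≤ ℓ) (T β : ℝ) (hT : 0 < T) (hβ : 0 < β)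
    (hT3 : (G.maxDegree : ℝ) ^ (ℓ + 1) ≤ T ^ 3)
    (hN : β + ((G.maxDegree : ℝ) ^ ℓ + T ^ 2) +
      β⁻¹ * ((ℓ + 2) * (T * (G.maxDegree : ℝ) ^ (ℓ + 1))) +
      β⁻¹ ^ 2 * ((n + 1) ^ 6 * (G.maxDegree : ℝ) ^ n) ≤ N)
    (L : V → Finset ℕ) (hL : ∀ v, #(L v) = N) :
    ∃ c : V → ℕ, (∀ v, c v ∈ L v) ∧ IsGoodOn G ℓ n T univ c := by
  refine exists_valid_coloring_of_certificates L N hL (IsGoodOn G ℓ n T) ?_ ?_ ?_ β hβ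
    (fun v => G.Certificate ℓ n T v)
    (fun v => Sum.elim (fun _ => {v}) (Sum.elim (fun e => {v, e.1.2.1.1.getVert e.2})
      fun e => {v, (e.2.1.2.1.reverse.append e.2.2.1.2.1).getVert (e.2.2.2 0),
        (e.2.1.2.1.reverse.append e.2.2.1.2.1).getVert (e.2.2.2 1)}))
    (fun v => Sum.elim (fun u _ => u.1)
      (Sum.elim (fun e x => if x = v then e.1.1 else e.1.2.2.1.getVert (ℓ + 1 - e.2))
      fun e x => if x = v then (e.2.1.2.1.reverse.append e.2.2.1.2.1).getVert (e.2.2.2 2) else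
        if x = (e.2.1.2.1.reverse.append e.2.2.1.2.1).getVert (e.2.2.2 0) then
          (e.2.1.2.1.reverse.append e.2.2.1.2.1).getVert (e.2.2.2 3) else
          (e.2.1.2.1.reverse.append e.2.2.1.2.1).getVert (e.2.2.2 4)))
    (fun v => Sum.elim (fun _ => 0) (Sum.elim (fun _ => 1) fun _ => 2)) ?_ ?_
  · exact fun S S' c hS h => ⟨fun u hu v hv => h.1 u (hS hu) v (hS hv),
      fun a ha b hb a' ha' b' hb' => h.2.1 a (hS ha) b (hS hb) a' (hS ha') b' (hS hb'),
      fun x y p hp X hX => h.2.2 x y p hp X (hX.trans hS)⟩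
  · intro S c c' hcc h
    refine ⟨fun u hu v hv huv => ?_, fun a ha b hb a' ha' b' hb' hab => ?_,
      fun x y p hp X hX hXp => ?_⟩
    · rw [← hcc u hu, ← hcc v hv]; exact h.1 u hu v hv huv
    · rw [← hcc a ha, ← hcc b hb, ← hcc a' ha', ← hcc b' hb']
      exact h.2.1 a ha b hb a' ha' b' hb' hab
    · rw [← image_congr (fun x hx => hcc x (hX hx))]
      exact h.2.2 x y p hp X hX hXp
  · intro c
    refine ⟨by simp, by simp, fun x y p _ X hX _ => ?_⟩
    rw [subset_empty.1 hX]; simp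
  · intro S v c hvS hval hnot
    by_cases h1 : ∀ u ∈ insert v S, ∀ w ∈ insert v S, G.Conflict ℓ T u w → c u ≠ c w
    · by_cases h2 : ∀ a ∈ insert v S, ∀ b ∈ insert v S, ∀ a' ∈ insert v S, ∀ b' ∈ insert v S,
        G.AntipodalPairs (ℓ + 1) a b a' b' → ¬ (c a = c a' ∧ c b = c b')
      · have h3 : ¬ ∀ (x y : V) (p : G.Walk x y), p.length = n → ∀ X ⊆ insert v S,
            X ⊆ p.support.toFinset → #X ≤ #(X.image c) + 2 := fun h3 => hnot ⟨h1, h2, h3⟩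
        push Not at h3
        obtain ⟨x, y, p, hp, X, hXS, hXp, hcard⟩ := h3
        have hsubS : X.erase v ⊆ S := fun z hz =>
          (mem_insert.1 (hXS (mem_of_mem_erase hz))).resolve_left (ne_of_mem_erase hz)
        have hvX : v ∈ X := by
          by_contra hvX
          rw [erase_eq_of_notMem hvX] at hsubS
          exact absurd (hval.2.2 x y p hp X hsubS hXp) (by omega)
        obtain ⟨d, e, f, hthree, hd, he, hf⟩ := exists_dependent_triple (by omega) hvX
          (hval.2.2 x y p hp _ hsubS ((erase_subset _ _).trans hXp))
        have hvp : v ∈ p.support := by simpa using hXp hvX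
        have hlen : (p.takeUntil v hvp).length + (p.dropUntil v hvp).length = n := by
          rw [← hp, ← Walk.length_append, p.take_spec hvp]
        have hpos : ∀ z ∈ X, ∃ j : Fin (n + 1), p.getVert j = z := by
          intro z hz
          have : z ∈ p.support := by simpa using hXp hz
          obtain ⟨j, hj, hj'⟩ := Walk.mem_support_iff_exists_getVert.1 this
          exact ⟨⟨j, by omega⟩, hj⟩
        have hfX : ∀ z ∈ ({v, d, e} : Finset V), f z ∈ X := fun z hz => (mem_sdiff.1 (hf z hz).1).1
        obtain ⟨j0, hj0⟩ := hpos d hd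
        obtain ⟨j1, hj1⟩ := hpos e he
        obtain ⟨j2, hj2⟩ := hpos (f v) (hfX v (by simp))
        obtain ⟨j3, hj3⟩ := hpos (f d) (hfX d (by simp))
        obtain ⟨j4, hj4⟩ := hpos (f e) (hfX e (by simp))
        refine ⟨Sum.inr (Sum.inr ⟨⟨(p.takeUntil v hvp).length, by omega⟩,
          ⟨x, (p.takeUntil v hvp).reverse, by simp⟩,
          ⟨y, p.dropUntil v hvp, by simp; omega⟩, ![j0, j1, j2, j3, j4]⟩), ?_⟩
        simp only [Sum.elim_inr, Walk.reverse_reverse, Walk.take_spec, Matrix.cons_val, hj0, hj1,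
          hj2, hj3, hj4]
        have hsub : ({v, d, e} : Finset V) ⊆ X := by
          simp [insert_subset_iff, hvX, hd, he]
        refine ⟨by simp, hsub.trans hXS, hthree, fun z hz => ?_⟩
        have hfz : (if z = v then f v else if z = d then f d else f e) = f z := by
          simp only [mem_insert, mem_singleton] at hz
          split_ifs with h h'
          · rw [h]
          · rw [h']
          · rw [(hz.resolve_left h).resolve_left h']
        rw [hfz]
        obtain ⟨hf1, hf2⟩ := hf z hz
        rw [mem_sdiff] at hf1 ⊢
        refine ⟨⟨(mem_insert.1 (hXS hf1.1)).resolve_left ?_, hf1.2⟩, hf2⟩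
        rintro h
        exact hf1.2 (by simp [h])
      · push Not at h2
        obtain ⟨a, ha, b, hb, a', ha', b', hb', hab, hca, hcb⟩ := h2
        obtain ⟨b, a', b', hb, ha', hb', hab, hca, hcb⟩ : ∃ b a' b', b ∈ insert v S ∧
            a' ∈ insert v S ∧ b' ∈ insert v S ∧ G.AntipodalPairs (ℓ + 1) v b a' b' ∧
            c v = c a' ∧ c b = c b' := by
          by_cases h : v = a
          · subst h; exact ⟨b, a', b', hb, ha', hb', hab, hca, hcb⟩
          by_cases h : v = b
          · subst h; exact ⟨a', b', a, ha', hb', ha, hab.rotate, hcb, hca.symm⟩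
          by_cases h : v = a'
          · subst h; exact ⟨b', a, b, hb', ha, hb, hab.rotate.rotate, hca.symm, hcb.symm⟩
          by_cases h : v = b'
          · subst h; exact ⟨a, b, a', ha, hb, ha', hab.rotate.rotate.rotate, hcb.symm, hca⟩
          rw [mem_insert] at ha hb ha' hb'
          exact absurd ⟨hca, hcb⟩ (hval.2.1 a (ha.resolve_left (Ne.symm ‹_›)) b
            (hb.resolve_left (Ne.symm ‹_›)) a' (ha'.resolve_left (Ne.symm ‹_›)) b'
            (hb'.resolve_left (Ne.symm ‹_›)) hab)
        obtain ⟨j, hj, p, q, hp, hq, hpj, hqj⟩ := hab.exists_walks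
        obtain ⟨n1, n2, n3, n4, n5, n6⟩ := hab.1
        have hspec : ¬ T < ((G.adjMatrix ℕ ^ (ℓ + 1)) v a' : ℝ) := fun h =>
          h1 v (mem_insert_self _ _) a' ha' ⟨n2, Or.inr h⟩ hca
        refine ⟨Sum.inr (Sum.inl ⟨⟨⟨a', hspec⟩, ⟨p, hp⟩, ⟨q, hq⟩⟩, ⟨j, by omega⟩⟩), ?_⟩
        rw [mem_insert] at ha' hb'
        simp only [Sum.elim_inr, Sum.elim_inl, hpj, hqj]
        refine ⟨by simp, ?_, by rw [card_pair n1], ?_⟩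
        · intro z hz
          rw [mem_insert, mem_singleton] at hz
          rcases hz with rfl | rfl
          exacts [mem_insert_self _ _, hb]
        · intro z hz
          rw [mem_insert, mem_singleton] at hz
          rcases hz with rfl | rfl
          · rw [if_pos rfl]
            exact ⟨by simp [n2.symm, n4.symm, ha'.resolve_left n2.symm], hca⟩
          · rw [if_neg n1.symm]
            exact ⟨by simp [n3.symm, n5.symm, hb'.resolve_left n3.symm], hcb⟩
    · push Not at h1
      obtain ⟨u, hu, w, hw, huw, hc⟩ := h1
      obtain ⟨w, hw, hvw, hc⟩ : ∃ w ∈ S, G.Conflict ℓ T v w ∧ c v = c w := by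
        rw [mem_insert] at hu hw
        rcases hu with rfl | hu
        · exact ⟨w, hw.resolve_left huw.1.symm, huw, hc⟩
        · rcases hw with rfl | hw
          · exact ⟨u, hu, huw.symm, hc.symm⟩
          · exact absurd hc (hval.1 u hu w hw huw)
      refine ⟨Sum.inl ⟨w, hvw⟩, ?_⟩
      simp [hw, hc, hvw.1.symm]
  · intro v
    rw [Fintype.sum_sum_type, Fintype.sum_sum_type]
    simp only [Sum.elim_inl, Sum.elim_inr, pow_zero, pow_one, sum_const, nsmul_eq_mul, mul_one,
      card_univ]
    refine le_trans ?_ hN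
    have e1 := G.card_filter_conflict_le ℓ hℓ T hT v hT3
    rw [← Fintype.card_subtype] at e1
    have e2 := G.card_walk_pairs_le ℓ T hT v
    have e3 : (Fintype.card (Σ i : Fin (n + 1), G.WalksFrom v i × G.WalksFrom v (n - i) ×
        (Fin 5 → Fin (n + 1))) : ℝ) ≤ (n + 1) ^ 6 * (G.maxDegree : ℝ) ^ n := by
      exact_mod_cast G.card_split_walks_le n v
    rw [Fintype.card_prod, Fintype.card_fin, mul_comm _ (β⁻¹), mul_comm _ (β⁻¹ ^ 2), ← add_assoc,
      ← add_assoc]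
    rw [mul_comm ((ℓ : ℝ) + 2)]
    push_cast
    gcongr

end

namespace SimpleGraph.Walk

variable {V : Type*} {G : SimpleGraph V}

theorem exists_length_eq_sub {u v : V} (w : G.Walk u v) {i j : ℕ} (hij : i ≤ j)
    (hj : j ≤ w.length) : ∃ p : G.Walk (w.getVert i) (w.getVert j), p.length = j - i := by
  induction j, hij using Nat.le_induction with
  | base => exact ⟨nil, by simp⟩
  | succ j hij ih =>
    obtain ⟨p, hp⟩ := ih (by omega)
    exact ⟨p.concat (w.adj_getVert_succ (by omega)), by rw [length_concat]; omega⟩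

theorem exists_length_eq_sub_add {v : V} (w : G.Walk v v) {i j : ℕ} (hij : i ≤ j)
    (hj : j ≤ w.length) :
    ∃ p : G.Walk (w.getVert j) (w.getVert i), p.length = w.length - j + i := by
  obtain ⟨p, hp⟩ := w.exists_length_eq_sub hj le_rfl
  obtain ⟨q, hq⟩ := w.exists_length_eq_sub (Nat.zero_le i) (hij.trans hj)
  exact ⟨(p.copy rfl (by rw [getVert_length, getVert_zero])).append q, by simp; omega⟩

end SimpleGraph.Walk

section

variable {V : Type*} [Fintype V] [DecidableEq V] {G : SimpleGraph V} [DecidableRel G.Adj]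

open Finset in
theorem IsGoodOn.le_card_colors {ℓ : ℕ} {T : ℝ} {c : V → ℕ} (hℓ : 1 ≤ ℓ)
    (h : IsGoodOn G ℓ (2 * ℓ + 2) T univ c) {v : V} (w : G.Walk v v) (hw : w.IsCycle) :
    min w.length (2 * ℓ + 1) ≤ #(w.support.map c).toFinset := by
  set f : ℕ → ℕ := fun i => c (w.getVert i) with hf
  have himage : ∀ s : Finset ℕ, s.image f ⊆ (w.support.map c).toFinset := by
    intro s k hk
    obtain ⟨i, -, rfl⟩ := mem_image.1 hk
    rw [List.mem_toFinset]
    exact List.mem_map_of_mem (w.getVert_mem_support i)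
  have hne : ∀ i j, i < j → j < w.length → w.getVert i ≠ w.getVert j := by
    intro i j hij hj heq
    have := hw.getVert_injOn' (show i ≤ w.length - 1 by omega) (show j ≤ w.length - 1 by omega) heq
    omega
  have hfar : ∀ i j, i < j → j < w.length → f i = f j → ℓ < j - i ∧ ℓ < w.length - j + i := by
    intro i j hij hj hc
    by_contra hnot
    refine h.1 (w.getVert i) (mem_univ _) (w.getVert j) (mem_univ _) ⟨hne i j hij hj, Or.inl ?_⟩ hc
    rw [not_and_or, not_lt, not_lt] at hnot
    rcases hnot with hle | hle
    · obtain ⟨p, hp⟩ := w.exists_length_eq_sub hij.le hj.le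
      exact ⟨p, hp ▸ hle⟩
    · obtain ⟨p, hp⟩ := w.exists_length_eq_sub_add hij.le hj.le
      exact ⟨p.reverse, by rw [Walk.length_reverse]; omega⟩
  have hinj : ∀ s : Finset ℕ, (∀ i ∈ s, ∀ j ∈ s, i < j → f i ≠ f j) →
      #s ≤ #(w.support.map c).toFinset := by
    intro s hs
    rw [← card_image_of_injOn (f := f) (s := s)]
    · exact card_le_card (himage s)
    · intro i hi j hj hij
      rcases lt_trichotomy i j with hlt | rfl | hlt
      · exact absurd hij (hs i hi j hj hlt)
      · rfl
      · exact absurd hij.symm (hs j hj i hi hlt)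
  rcases lt_trichotomy w.length (2 * ℓ + 2) with hlen | hlen | hlen
  · refine (min_le_left _ _).trans ?_
    rw [← card_range w.length]
    refine hinj _ fun i _ j hj hij hc => ?_
    have := hfar i j hij (mem_range.1 hj) hc
    have := mem_range.1 hj
    omega
  · refine (min_le_right _ _).trans ?_
    set B := (range (ℓ + 1)).filter fun i => f i = f (i + (ℓ + 1)) with hB
    have hBcard : #B ≤ 1 := by
      by_contra hlt
      obtain ⟨i, hi, j, hj, hij⟩ : ∃ i ∈ B, ∃ j ∈ B, i < j := by
        obtain ⟨i, hi, j, hj, hij⟩ := one_lt_card.1 (not_le.1 hlt)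
        rcases lt_or_gt_of_ne hij with hlt | hlt
        exacts [⟨i, hi, j, hj, hlt⟩, ⟨j, hj, i, hi, hlt⟩]
      rw [hB, mem_filter, mem_range] at hi hj
      refine h.2.1 (w.getVert i) (mem_univ _) (w.getVert j) (mem_univ _)
        (w.getVert (i + (ℓ + 1))) (mem_univ _) (w.getVert (j + (ℓ + 1))) (mem_univ _)
        ⟨⟨hne _ _ hij (by omega), hne _ _ (by omega) (by omega), hne _ _ (by omega) (by omega),
          hne _ _ (by omega) (by omega), hne _ _ (by omega) (by omega),
          hne _ _ (by omega) (by omega)⟩, j - i, i + (ℓ + 1) - j, by omega, ?_, ?_, ?_, ?_⟩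
        ⟨hi.2, hj.2⟩
      · exact w.exists_length_eq_sub hij.le (by omega)
      · exact w.exists_length_eq_sub (by omega) (by omega)
      · obtain ⟨p, hp⟩ := w.exists_length_eq_sub (i := i + (ℓ + 1)) (j := j + (ℓ + 1))
          (by omega) (by omega)
        exact ⟨p, by omega⟩
      · obtain ⟨p, hp⟩ := w.exists_length_eq_sub_add (i := i) (j := j + (ℓ + 1))
          (by omega) (by omega)
        exact ⟨p, by omega⟩
    have hsdiff := le_card_sdiff B (range w.length)
    rw [card_range] at hsdiff
    refine le_trans (by omega) (hinj (range w.length \ B) fun i hi j hj hij hc => ?_)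
    rw [mem_sdiff, mem_range] at hi hj
    have := hfar i j hij hj.1 hc
    have hj' : j = i + (ℓ + 1) := by omega
    subst hj'
    exact hi.2 (mem_filter.2 ⟨mem_range.2 (by omega), hc⟩)
  · refine (min_le_right _ _).trans ?_
    have hcard : #((range (2 * ℓ + 3)).image w.getVert) = 2 * ℓ + 3 := by
      rw [card_image_of_injOn, card_range]
      intro i hi j hj hij
      rw [mem_coe, mem_range] at hi hj
      exact hw.getVert_injOn' (show i ≤ w.length - 1 by omega) (show j ≤ w.length - 1 by omega) hij
    have hsupp : (range (2 * ℓ + 3)).image w.getVert ⊆ (w.take (2 * ℓ + 2)).support.toFinset := by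
      intro x hx
      obtain ⟨i, hi, rfl⟩ := mem_image.1 hx
      rw [mem_range] at hi
      rw [List.mem_toFinset]
      have := (w.take (2 * ℓ + 2)).getVert_mem_support i
      rwa [Walk.take_getVert, min_eq_right (by omega)] at this
    have hfew := h.2.2 _ _ (w.take (2 * ℓ + 2)) (by rw [Walk.take_length]; omega) _
      (subset_univ _) hsupp
    rw [hcard, image_image] at hfew
    have := card_le_card (himage (range (2 * ℓ + 3)))
    change #((range (2 * ℓ + 3)).image (c ∘ w.getVert)) ≤ _ at this
    omega

end

theorem IsGoodOn.isRAcyclicColoring {V : Type} [Fintype V] [DecidableEq V] {G : SimpleGraph V}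
    [DecidableRel G.Adj] {ℓ : ℕ} {T : ℝ} {c : V → ℕ} (hℓ : 1 ≤ ℓ)
    (h : IsGoodOn G ℓ (2 * ℓ + 2) T Finset.univ c) : IsRAcyclicColoring G (2 * ℓ + 1) c :=
  ⟨fun u v huv => h.1 u (Finset.mem_univ _) v (Finset.mem_univ _)
    ⟨huv.ne, Or.inl ⟨huv.toWalk, by simpa using hℓ⟩⟩,
    fun _ w hw => h.le_card_colors hℓ w hw⟩

theorem stmt8 {V : Type} [Fintype V] (G : SimpleGraph V) [DecidableRel G.Adj]
    (Δ : ℕ) (hΔ : G.maxDegree = Δ) (h3 : 3 ≤ Δ)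
    (ℓ : ℕ) (hℓ : 2 ≤ ℓ) (r : ℕ) (hr : r = 2 * ℓ + 1) :
    rAcyclicChoiceNumber G r ≤
      ⌈(Δ : ℝ) ^ ℓ + (2 + (ℓ : ℝ) + (1 / 2) * ((r : ℝ) + 2) ^ 6)
        * (Δ : ℝ) ^ (((r : ℝ) + 1) / 3)⌉₊ := by
  classical
  subst hr
  set T : ℝ := (Δ : ℝ) ^ (((ℓ : ℝ) + 1) / 3) with hTdef
  have hΔ0 : (0 : ℝ) < Δ := by exact_mod_cast (by omega : 0 < Δ)
  have hT : 0 < T := Real.rpow_pos_of_pos hΔ0 _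
  have hT3 : T ^ 3 = (Δ : ℝ) ^ (ℓ + 1) := by
    rw [hTdef, ← Real.rpow_mul_natCast hΔ0.le, ← Real.rpow_natCast]
    congr 1
    push_cast
    ring
  have hT2 : (Δ : ℝ) ^ ((((2 * ℓ + 1 : ℕ) : ℝ) + 1) / 3) = T ^ 2 := by
    rw [hTdef, ← Real.rpow_mul_natCast hΔ0.le]
    congr 1
    push_cast
    ring
  rw [hT2]
  refine Nat.sInf_le fun L hL => ?_
  suffices hN : 2 * T ^ 2 + ((G.maxDegree : ℝ) ^ ℓ + T ^ 2) +
      (2 * T ^ 2)⁻¹ * ((ℓ + 2) * (T * (G.maxDegree : ℝ) ^ (ℓ + 1))) +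
      (2 * T ^ 2)⁻¹ ^ 2 * ((((2 * ℓ + 2 : ℕ) : ℝ) + 1) ^ 6 * (G.maxDegree : ℝ) ^ (2 * ℓ + 2)) ≤
      (Δ : ℝ) ^ ℓ + (2 + (ℓ : ℝ) + (1 / 2) * (((2 * ℓ + 1 : ℕ) : ℝ) + 2) ^ 6) * T ^ 2 by
    obtain ⟨c, hc, hgood⟩ := exists_isGoodOn_univ G ℓ (2 * ℓ + 2) _ (by omega) T (2 * T ^ 2) hT
      (by positivity) (by rw [hΔ, hT3]) (hN.trans (Nat.le_ceil _)) L hL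
    exact ⟨c, hc, hgood.isRAcyclicColoring (by omega)⟩
  have hT6 : (Δ : ℝ) ^ (2 * ℓ + 2) = T ^ 6 := by
    rw [show T ^ 6 = (T ^ 3) ^ 2 by ring, hT3, ← pow_mul]
    congr 1
    ring
  rw [hΔ, hT6, ← hT3]
  have h1 : (2 * T ^ 2)⁻¹ * (((ℓ : ℝ) + 2) * (T * T ^ 3)) = ((ℓ : ℝ) + 2) / 2 * T ^ 2 := by
    field_simp
  have h2 : (2 * T ^ 2)⁻¹ ^ 2 * ((((2 * ℓ + 2 : ℕ) : ℝ) + 1) ^ 6 * T ^ 6) =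
      (((2 * ℓ + 1 : ℕ) : ℝ) + 2) ^ 6 / 4 * T ^ 2 := by
    push_cast
    field_simp
    ring
  rw [h1, h2]
  have hK : (4 : ℝ) ≤ (((2 * ℓ + 1 : ℕ) : ℝ) + 2) ^ 6 := by
    calc (4 : ℝ) ≤ 2 ^ 6 := by norm_num
      _ ≤ _ := by gcongr; push_cast; linarith [(Nat.cast_nonneg ℓ : (0 : ℝ) ≤ ℓ)]
  have hℓ' : (2 : ℝ) ≤ ℓ := by exact_mod_cast hℓ
  nlinarith [sq_nonneg T]
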